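/- For every j ≥ 1 the row vector of polynomials 𝐐_{[0,j]}(λ) = (Q_{0,0}(λ),…,Q_{0,k_0−1}(λ),…,Q_{j,0}(λ),…,Q_{j,k_j−1}(λ)), where Q_{i,k}(λ) = λ^k Q_i(λ), satisfies the identity 𝐐_{[0,j]}(λ) · (λ·I − H_{[0,j]}) = (0,…,0,−ε_0,0,…,0, b_j Q_{j+1}(λ)), where −ε_0 stands in coordinate k_0 − 1 (0-based), b_j Q_{j+1}(λ) in the last coordinate, and all other coordinates vanish. -/

import Mathlib

open Polynomial

/-- Polynomials of the first kind: `P_0 = 1`, `P_1 = p_0 / b_0`, and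
`b_{j+1} P_{j+2} = p_{j+1} P_{j+1} - ε_j ε_{j+1} b_j P_j`. -/
noncomputable def genP (ε b : ℕ → ℝ) (p : ℕ → Polynomial ℝ) : ℕ → Polynomial ℝ
  | 0 => 1
  | 1 => Polynomial.C (b 0)⁻¹ * p 0
  | (j + 2) => Polynomial.C (b (j + 1))⁻¹ *
      (p (j + 1) * genP ε b p (j + 1) -
        Polynomial.C (ε j * ε (j + 1) * b j) * genP ε b p j)

/-- Polynomials of the second kind: `Q_0 = 0`, `Q_1 = ε_0 / b_0`, same recurrence. -/
noncomputable def genQ (ε b : ℕ → ℝ) (p : ℕ → Polynomial ℝ) : ℕ → Polynomial ℝ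
  | 0 => 0
  | 1 => Polynomial.C (ε 0 / b 0)
  | (j + 2) => Polynomial.C (b (j + 1))⁻¹ *
      (p (j + 1) * genQ ε b p (j + 1) -
        Polynomial.C (ε j * ε (j + 1) * b j) * genQ ε b p j)

/-- `nsum k j = n_j = k_0 + ⋯ + k_{j-1}`. -/
def nsum (k : ℕ → ℕ) (j : ℕ) : ℕ := ∑ i ∈ Finset.range j, k i

/-- The index `i` of the block containing the global row/column index `r`,
i.e. the greatest `i` with `n_i ≤ r` (assuming all `k i ≥ 1`). -/
def blkIdx (k : ℕ → ℕ) (r : ℕ) : ℕ := Nat.findGreatest (fun i => nsum k i ≤ r) r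

/-- Entry of the (infinite) generalized Jacobi matrix at global position `(r, c)`:
diagonal blocks are companion matrices `C_{p_i}`, subdiagonal blocks `B_i` have the
single nonzero entry `b_i` in the top-right corner, superdiagonal blocks `B̃_i` have
the single nonzero entry `ε_i ε_{i+1} b_i` in the top-right corner. -/
noncomputable def Jentry (ε b : ℕ → ℝ) (p : ℕ → Polynomial ℝ) (k : ℕ → ℕ) (r c : ℕ) : ℝ :=
  let i := blkIdx k r
  let i' := blkIdx k c
  let a := r - nsum k i
  let a' := c - nsum k i'
  if i = i' then
    (if a' = k i - 1 then -((p i).coeff a) else if a = a' + 1 then 1 else 0)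
  else if i = i' + 1 then
    (if a = 0 ∧ a' = k i' - 1 then b i' else 0)
  else if i' = i + 1 then
    (if a = 0 ∧ a' = k i' - 1 then ε i * ε i' * b i else 0)
  else 0

/-- The finite generalized Jacobi matrix built from the blocks indexed `0, …, m-1`;
it has size `n_m × n_m`.  Thus `H_{[0,j]} = JmatN ε b p k (j+1)`. -/
noncomputable def JmatN (ε b : ℕ → ℝ) (p : ℕ → Polynomial ℝ) (k : ℕ → ℕ) (m : ℕ) :
    Matrix (Fin (nsum k m)) (Fin (nsum k m)) ℝ :=
  Matrix.of fun r c => Jentry ε b p k (r : ℕ) (c : ℕ)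

/-- The row vector `𝐐_{[0,j]}(λ)` whose coordinate at global index `r = n_i + k`
(`0 ≤ k < k_i`) is `Q_{i,k}(λ) = λ^k Q_i(λ)`; here `m = j + 1` is the number of blocks. -/
noncomputable def QvecN (ε b : ℕ → ℝ) (p : ℕ → Polynomial ℝ) (k : ℕ → ℕ) (m : ℕ) :
    Fin (nsum k m) → Polynomial ℝ :=
  fun r => Polynomial.X ^ ((r : ℕ) - nsum k (blkIdx k (r : ℕ))) *
    genQ ε b p (blkIdx k (r : ℕ))

theorem nsum_succ (k : ℕ → ℕ) (j : ℕ) : nsum k (j + 1) = nsum k j + k j :=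
  Finset.sum_range_succ k j

theorem nsum_mono (k : ℕ → ℕ) : Monotone (nsum k) :=
  monotone_nat_of_le_succ fun j => by rw [nsum_succ]; omega

theorem le_nsum {k : ℕ → ℕ} (hk : ∀ j, 1 ≤ k j) (j : ℕ) : j ≤ nsum k j := by
  induction j with
  | zero => exact Nat.zero_le _
  | succ j ih =>
    rw [nsum_succ]
    have := hk j
    omega

theorem blkIdx_nsum_add {k : ℕ → ℕ} (hk : ∀ j, 1 ≤ k j) {i a : ℕ} (ha : a < k i) :
    blkIdx k (nsum k i + a) = i := by
  refine (Nat.findGreatest_eq_iff).2 ⟨(le_nsum hk i).trans (Nat.le_add_right _ _),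
    fun _ => Nat.le_add_right _ _, fun n hn _ h => ?_⟩
  have := nsum_mono k (Nat.succ_le_of_lt hn)
  rw [nsum_succ] at this
  omega

theorem exists_eq_nsum_add (k : ℕ → ℕ) {m r : ℕ} (hr : r < nsum k m) :
    ∃ i a, i < m ∧ a < k i ∧ r = nsum k i + a := by
  induction m with
  | zero => simp [nsum] at hr
  | succ m ih =>
    by_cases h : r < nsum k m
    · obtain ⟨i, a, hi, ha, rfl⟩ := ih h
      exact ⟨i, a, by omega, ha, rfl⟩
    · rw [nsum_succ] at hr
      exact ⟨m, r - nsum k m, by omega, by omega, by omega⟩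

theorem sum_range_nsum {M : Type*} [AddCommMonoid M] (k : ℕ → ℕ) (f : ℕ → M) (m : ℕ) :
    ∑ r ∈ Finset.range (nsum k m), f r =
      ∑ i ∈ Finset.range m, ∑ a ∈ Finset.range (k i), f (nsum k i + a) := by
  induction m with
  | zero => simp [nsum]
  | succ m ih => rw [nsum_succ, Finset.sum_range_add, ih, Finset.sum_range_succ]

theorem Jentry_nsum_add (ε b : ℕ → ℝ) (p : ℕ → Polynomial ℝ) {k : ℕ → ℕ} (hk : ∀ j, 1 ≤ k j)
    {i a i' a' : ℕ} (ha : a < k i) (ha' : a' < k i') :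
    Jentry ε b p k (nsum k i + a) (nsum k i' + a') =
      if i = i' then
        (if a' = k i - 1 then -((p i).coeff a) else if a = a' + 1 then 1 else 0)
      else if i = i' + 1 then (if a = 0 ∧ a' = k i' - 1 then b i' else 0)
      else if i' = i + 1 then (if a = 0 ∧ a' = k i' - 1 then ε i * ε i' * b i else 0)
      else 0 := by
  simp only [Jentry, blkIdx_nsum_add hk ha, blkIdx_nsum_add hk ha', Nat.add_sub_cancel_left]

/-- Contribution of the `i`-th row block to a column of `𝐐 · H` which is not the last one of its
block. -/
theorem sum_block_of_ne (ε b : ℕ → ℝ) (p : ℕ → Polynomial ℝ) {k : ℕ → ℕ} (hk : ∀ j, 1 ≤ k j)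
    (q : Polynomial ℝ) (i : ℕ) {i' a' : ℕ} (ha' : a' < k i') (hlast : a' ≠ k i' - 1) :
    ∑ a ∈ Finset.range (k i), X ^ a * q * C (Jentry ε b p k (nsum k i + a) (nsum k i' + a')) =
      if i = i' then X ^ (a' + 1) * q else 0 := by
  rw [Finset.sum_congr rfl fun a ha => by
    rw [Jentry_nsum_add ε b p hk (Finset.mem_range.1 ha) ha']]
  by_cases h : i = i'
  · subst h
    rw [Finset.sum_eq_single (a' + 1)]
    · simp [hlast]
    · intro a _ hne
      simp [hlast, hne]
    · intro hmem
      exact absurd (Finset.mem_range.2 (by omega)) hmem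
  · simp [hlast, h]

/-- Contribution of the `i`-th row block to the last column of the `i'`-th column block of
`𝐐 · H`. -/
theorem sum_block_last (ε b : ℕ → ℝ) {p : ℕ → Polynomial ℝ} {k : ℕ → ℕ}
    (hp : ∀ j, (p j).Monic) (hdeg : ∀ j, (p j).natDegree = k j) (hk : ∀ j, 1 ≤ k j)
    (q : Polynomial ℝ) (i i' : ℕ) :
    ∑ a ∈ Finset.range (k i),
        X ^ a * q * C (Jentry ε b p k (nsum k i + a) (nsum k i' + (k i' - 1))) =
      (if i = i' then (X ^ k i - p i) * q else 0) + (if i = i' + 1 then C (b i') * q else 0) +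
        (if i' = i + 1 then C (ε i * ε i' * b i) * q else 0) := by
  have hlt : k i' - 1 < k i' := by have := hk i'; omega
  have corner (x : ℝ) :
      ∑ a ∈ Finset.range (k i), X ^ a * q * C (if a = 0 then x else 0) = C x * q := by
    rw [Finset.sum_eq_single 0]
    · simp [mul_comm]
    · intro a _ hne
      simp [hne]
    · intro hmem
      exact absurd (Finset.mem_range.2 (hk i)) hmem
  rw [Finset.sum_congr rfl fun a ha => by
    rw [Jentry_nsum_add ε b p hk (Finset.mem_range.1 ha) hlt]]
  by_cases h : i = i'
  · subst h
    have hpi := (hp i).as_sum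
    rw [hdeg] at hpi
    have hsub : X ^ k i - p i = -∑ a ∈ Finset.range (k i), C ((p i).coeff a) * X ^ a := by
      linear_combination -hpi
    have hi : i ≠ i + 1 := by omega
    simp only [hsub, hi, if_true, if_false, add_zero, C_neg, neg_mul, mul_neg,
      Finset.sum_neg_distrib, Finset.sum_mul]
    exact congrArg _ (Finset.sum_congr rfl fun a _ => by ring)
  by_cases h1 : i = i' + 1
  · subst h1
    have hi : i' ≠ i' + 1 + 1 := by omega
    simpa [hi] using corner (b i')
  by_cases h2 : i' = i + 1
  · subst h2
    have hi : i ≠ i + 1 + 1 := by omega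
    simpa [hi] using corner (ε i * ε (i + 1) * b i)
  simp [h, h1, h2]

theorem b_mul_genQ_one (ε : ℕ → ℝ) {b : ℕ → ℝ} (p : ℕ → Polynomial ℝ) (hb : b 0 ≠ 0) :
    C (b 0) * genQ ε b p 1 = C (ε 0) := by
  rw [genQ, ← C_mul, mul_div_cancel₀ _ hb]

theorem b_mul_genQ_add_two (ε : ℕ → ℝ) {b : ℕ → ℝ} (p : ℕ → Polynomial ℝ) {j : ℕ}
    (hb : b (j + 1) ≠ 0) :
    C (b (j + 1)) * genQ ε b p (j + 2) =
      p (j + 1) * genQ ε b p (j + 1) - C (ε j * ε (j + 1) * b j) * genQ ε b p j := by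
  rw [genQ, ← mul_assoc, ← C_mul, mul_inv_cancel₀ hb, C_1, one_mul]

theorem QvecN_vecMul_charmatrix_apply (ε b : ℕ → ℝ) (p : ℕ → Polynomial ℝ) {k : ℕ → ℕ}
    (hk : ∀ j, 1 ≤ k j) {m i' a' : ℕ} (ha' : a' < k i') (hr : nsum k i' + a' < nsum k m) :
    Matrix.vecMul (QvecN ε b p k m) (JmatN ε b p k m).charmatrix ⟨nsum k i' + a', hr⟩ =
      X ^ (a' + 1) * genQ ε b p i' - ∑ i ∈ Finset.range m, ∑ a ∈ Finset.range (k i),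
        X ^ a * genQ ε b p i * C (Jentry ε b p k (nsum k i + a) (nsum k i' + a')) := by
  have hsum : ∑ r, QvecN ε b p k m r * C (JmatN ε b p k m r ⟨nsum k i' + a', hr⟩) =
      ∑ i ∈ Finset.range m, ∑ a ∈ Finset.range (k i),
        X ^ a * genQ ε b p i * C (Jentry ε b p k (nsum k i + a) (nsum k i' + a')) := by
    simp only [QvecN, JmatN, Matrix.of_apply]
    rw [Fin.sum_univ_eq_sum_range (fun r => X ^ (r - nsum k (blkIdx k r)) *
      genQ ε b p (blkIdx k r) * C (Jentry ε b p k r (nsum k i' + a'))), sum_range_nsum]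
    refine Finset.sum_congr rfl fun i _ => Finset.sum_congr rfl fun a ha => ?_
    rw [blkIdx_nsum_add hk (Finset.mem_range.1 ha), Nat.add_sub_cancel_left]
  rw [← hsum]
  simp only [Matrix.vecMul, dotProduct, Matrix.charmatrix_apply, mul_sub, Finset.sum_sub_distrib,
    Matrix.diagonal_apply, mul_ite, mul_zero, Finset.sum_ite_eq', Finset.mem_univ, if_true]
  simp only [QvecN, blkIdx_nsum_add hk ha', Nat.add_sub_cancel_left]
  ring

/-- For every `j ≥ 1`, the row vector `𝐐_{[0,j]}(λ)` satisfies
`𝐐_{[0,j]}(λ) · (λ·I − H_{[0,j]}) = (0,…,0,−ε_0,0,…,0, b_j Q_{j+1}(λ))`, where `−ε_0`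
stands in coordinate `k_0 − 1` (0-based), `b_j Q_{j+1}(λ)` in the last coordinate,
and all other coordinates vanish. -/
theorem Qvec_vecMul_charmatrix (ε b : ℕ → ℝ) (p : ℕ → Polynomial ℝ) (k : ℕ → ℕ)
    (hε : ∀ j, ε j = 1 ∨ ε j = -1) (hb : ∀ j, 0 < b j)
    (hp : ∀ j, (p j).Monic) (hdeg : ∀ j, (p j).natDegree = k j) (hk : ∀ j, 1 ≤ k j) :
    ∀ j : ℕ, 1 ≤ j →
      Matrix.vecMul (QvecN ε b p k (j + 1)) (Matrix.charmatrix (JmatN ε b p k (j + 1))) =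
        fun (r : Fin (nsum k (j + 1))) =>
          if (r : ℕ) = k 0 - 1 then -Polynomial.C (ε 0)
          else if (r : ℕ) = nsum k (j + 1) - 1
            then Polynomial.C (b j) * genQ ε b p (j + 1) else 0 := by
  intro j hj
  funext ⟨r, hr⟩
  obtain ⟨i', a', hi', ha', rfl⟩ := exists_eq_nsum_add k hr
  have hzero : nsum k 0 = 0 := rfl
  have hsucc := nsum_succ k i'
  have hfirst (h : i' ≠ 0) : k 0 ≤ nsum k i' := by
    have := nsum_mono k (Nat.one_le_iff_ne_zero.2 h)
    rwa [nsum_succ, hzero, zero_add] at this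
  have hlater (h : i' ≠ j) : nsum k (i' + 1) < nsum k (j + 1) := by
    have := nsum_mono k (show i' + 1 ≤ j by omega)
    have := nsum_succ k j
    have := hk j
    omega
  have hk0 := hk 0
  rw [QvecN_vecMul_charmatrix_apply ε b p hk ha']
  by_cases hlast : a' = k i' - 1
  · subst hlast
    have hpow : k i' - 1 + 1 = k i' := by omega
    simp only [sum_block_last ε b hp hdeg hk, Finset.sum_add_distrib, Finset.sum_ite_eq',
      Finset.mem_range, hi', if_true, hpow]
    rcases i' with _ | i
    · have hj1 : 0 + 1 < j + 1 := by omega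
      simpa [hzero, hj1, genQ] using b_mul_genQ_one ε p (hb 0).ne'
    · have hne : nsum k (i + 1) + (k (i + 1) - 1) ≠ k 0 - 1 := by
        have := hfirst (by omega)
        have := hk (i + 1)
        omega
      have hrec := b_mul_genQ_add_two ε p (hb (i + 1)).ne'
      simp only [add_left_inj, Finset.sum_ite_eq, Finset.mem_range, hne, if_false,
        show i < j + 1 by omega, if_true]
      by_cases hij : i + 1 = j
      · subst hij
        rw [if_neg (lt_irrefl _), if_pos (by omega), hrec]
        ring
      · rw [if_pos (by omega), if_neg (by have := hlater hij; omega), hrec]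
        ring
  · have hne : nsum k i' + a' ≠ k 0 - 1 := by
      rcases eq_or_ne i' 0 with rfl | h
      · omega
      · have := hfirst h
        omega
    have hne' : nsum k i' + a' ≠ nsum k (j + 1) - 1 := by
      rcases eq_or_ne i' j with rfl | h
      · omega
      · have := hlater h
        omega
    simp only [sum_block_of_ne ε b p hk _ _ ha' hlast, Finset.sum_ite_eq', Finset.mem_range, hi',
      if_true, hne, hne', if_false, sub_self]
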